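/- arXiv:math/9807175 — 4 statements merged into one kernel-verified Lean document; each statement's English description precedes it below -/
import Mathlib

section
/- For every positive integer j, the poset P_j has width j, height j+2, and cardinality binom(j+2, 2). -/
/-- The maximum cardinality of a union of `k` antichains (a `k`-family)
with respect to the relation `r`. -/
noncomputable def dFam {α : Type*} (r : α → α → Prop) (k : ℕ) : ℕ :=
  sSup {n | ∃ A : Fin k → Set α, (∀ i, IsAntichain r (A i)) ∧ (⋃ i, A i).ncard = n}

/-- The height of a poset: the maximum cardinality of a chain. -/
noncomputable def heightPO {α : Type*} (r : α → α → Prop) : ℕ :=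
  sSup {n | ∃ s : Set α, IsChain r s ∧ s.ncard = n}

/-- The width of a poset: the maximum cardinality of an antichain. -/
noncomputable def widthPO {α : Type*} (r : α → α → Prop) : ℕ :=
  sSup {n | ∃ s : Set α, IsAntichain r s ∧ s.ncard = n}

/-- `f` encodes a partition of `α` into chains: its (nonempty) fibers are the chains. -/
def IsChainPartition {α : Type*} (r : α → α → Prop) (f : α → α) : Prop :=
  ∀ i : α, IsChain r (f ⁻¹' {i})

/-- The `k`-norm of the partition encoded by `f`: `Σ_C min (k, |C|)`. -/
noncomputable def knorm {α : Type*} [Fintype α] (f : α → α) (k : ℕ) : ℕ :=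
  ∑ i : α, min k (f ⁻¹' {i}).ncard

/-- A poset is polyunsaturated if no chain partition is simultaneously `k`- and
`l`-saturated for distinct nonconsecutive positive `k, l` below the height. -/
def PolyunsatPO {α : Type*} [Fintype α] (r : α → α → Prop) : Prop :=
  ∀ k l : ℕ, 0 < k → 0 < l → k < heightPO r → l < heightPO r →
    (k + 2 ≤ l ∨ l + 2 ≤ k) →
    ¬ ∃ f : α → α, IsChainPartition r f ∧ knorm f k = dFam r k ∧ knorm f l = dFam r l

/-- A poset has order dimension at most 2: two linear extensions whose
intersection is the order. -/
def DimLE2 {α : Type*} (r : α → α → Prop) : Prop :=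
  ∃ L₁ L₂ : α → α → Prop, IsLinearOrder α L₁ ∧ IsLinearOrder α L₂ ∧
    (∀ x y, r x y → L₁ x y) ∧ (∀ x y, r x y → L₂ x y) ∧
    (∀ x y, r x y ↔ L₁ x y ∧ L₂ x y)


/-- Size of the chain `Q i` in the construction of the poset `P j`. -/
def qsize (i : ℕ) : ℕ := if i = 1 then 3 else i + 1

/-- Position (from the bottom) of the element `s i` within the chain `Q i`. -/
def sposn (i : ℕ) : ℕ := qsize i - 2

/-- The underlying set of the poset `P j`: pairs `(i, m)` where `1 ≤ i ≤ j` indexes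
the chain `Q i` and `m < qsize i` is the position within that chain. -/
def PJ (j : ℕ) : Type :=
  {p : Fin (j + 1) × Fin (j + 2) // 1 ≤ p.1.val ∧ p.1.val ≤ j ∧ p.2.val < qsize p.1.val}

instance (j : ℕ) : Fintype (PJ j) := by unfold PJ; infer_instance

instance (j : ℕ) : DecidableEq (PJ j) := by unfold PJ; infer_instance

/-- The order relation of `P j`. -/
def ple {j : ℕ} (x y : PJ j) : Prop :=
  (x.val.1.val = y.val.1.val ∧ x.val.2.val ≤ y.val.2.val) ∨
  (x.val.1.val < y.val.1.val ∧ x.val.2.val ≤ sposn x.val.1.val ∧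
    sposn y.val.1.val ≤ y.val.2.val)

instance (j : ℕ) : PartialOrder (PJ j) where
  le := ple
  le_refl x := Or.inl ⟨rfl, le_rfl⟩
  le_trans x y z hxy hyz := by
    simp only [ple] at hxy hyz ⊢
    rcases hxy with ⟨h1, h2⟩ | ⟨h1, h2, h3⟩ <;> rcases hyz with ⟨g1, g2⟩ | ⟨g1, g2, g3⟩
    · exact Or.inl ⟨h1.trans g1, h2.trans g2⟩
    · refine Or.inr ⟨by omega, ?_, g3⟩
      rw [h1]; omega
    · refine Or.inr ⟨by omega, h2, ?_⟩
      rw [← g1]; omega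
    · exact Or.inr ⟨by omega, h2, g3⟩
  le_antisymm x y hxy hyx := by
    simp only [ple] at hxy hyx
    rcases hxy with ⟨h1, h2⟩ | ⟨h1, h2, h3⟩ <;> rcases hyx with ⟨g1, g2⟩ | ⟨g1, g2, g3⟩
    · exact Subtype.ext (Prod.ext (Fin.ext h1) (Fin.ext (le_antisymm h2 g2)))
    all_goals (exfalso; omega)

/-- The order of `P j`, as an explicit relation. -/
def pjle (j : ℕ) : PJ j → PJ j → Prop := (· ≤ ·)

/-- The element `u` of `P j`. -/
def uElt (j : ℕ) (hj : 1 ≤ j) : PJ j :=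
  ⟨(⟨1, by omega⟩, ⟨0, by omega⟩), le_refl 1, hj, by show 0 < qsize 1; decide⟩

/-- The element `s i` of `P j`. -/
def sElt (j i : ℕ) (h1 : 1 ≤ i) (h2 : i ≤ j) : PJ j :=
  ⟨(⟨i, by omega⟩, ⟨sposn i, by simp only [sposn, qsize]; split <;> omega⟩),
    h1, h2, by show sposn i < qsize i; simp only [sposn, qsize]; split <;> omega⟩

/-- The element `r i` of `P j`. -/
def rElt (j i : ℕ) (h1 : 1 ≤ i) (h2 : i ≤ j) : PJ j :=
  ⟨(⟨i, by omega⟩, ⟨qsize i - 1, by simp only [qsize]; split <;> omega⟩),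
    h1, h2, by show qsize i - 1 < qsize i; simp only [qsize]; split <;> omega⟩


theorem sSup_ncard_eq {α : Type*} {p : Set α → Prop} {n : ℕ}
    (hex : ∃ s, p s ∧ s.ncard = n) (hle : ∀ s, p s → s.ncard ≤ n) :
    sSup {m | ∃ s, p s ∧ s.ncard = m} = n :=
  IsGreatest.csSup_eq ⟨hex, by rintro _ ⟨s, hs, rfl⟩; exact hle s hs⟩

theorem sposn_add_two (i : ℕ) (hi : 1 ≤ i) : sposn i + 2 = qsize i := by
  unfold sposn qsize; split <;> omega

theorem PJ.ext_val {j : ℕ} {x y : PJ j} (h₁ : x.val.1.val = y.val.1.val)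
    (h₂ : x.val.2.val = y.val.2.val) : x = y :=
  Subtype.ext (Prod.ext (Fin.ext h₁) (Fin.ext h₂))

theorem widthPO_pjle (j : ℕ) : widthPO (pjle j) = j := by
  apply sSup_ncard_eq
  · let f : Fin j → PJ j := fun i => rElt j (i.val + 1) (by omega) (by omega)
    have hf : Function.Injective f := fun a b h => by
      have h' : a.val + 1 = b.val + 1 := congrArg (fun x : PJ j => x.val.1.val) h
      exact Fin.ext (by omega)
    refine ⟨Set.range f, ?_, by simp [Set.ncard_range_of_injective hf]⟩
    rintro _ ⟨a, rfl⟩ _ ⟨b, rfl⟩ hne hle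
    have hs := sposn_add_two (a.val + 1) (by omega)
    have hle' : (a.val + 1 = b.val + 1 ∧ _) ∨
      (_ ∧ qsize (a.val + 1) - 1 ≤ sposn (a.val + 1) ∧ _) := hle
    rcases hle' with h | h
    · exact hne (congrArg f (Fin.ext (by omega)))
    · omega
  · intro s hs
    have hinj : Set.InjOn (fun x : PJ j => x.val.1.val) s := by
      intro x hx y hy hxy
      by_contra hne
      rcases le_total x.val.2.val y.val.2.val with h | h
      · exact hs hx hy hne (Or.inl ⟨hxy, h⟩)
      · exact hs hy hx (Ne.symm hne) (Or.inl ⟨hxy.symm, h⟩)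
    have := Set.ncard_le_ncard_of_injOn (t := ↑(Finset.Icc 1 j)) _
      (fun x _ => by simpa using ⟨x.2.1, x.2.2.1⟩) hinj (Finset.finite_toSet _)
    simpa [Set.ncard_coe_finset] using this

/-- A strictly monotone function on `PJ j` whose values lie below `j + 2`. -/
def pjRank {j : ℕ} (x : PJ j) : ℕ :=
  if x.val.2.val < sposn x.val.1.val then x.val.2.val
  else x.val.1.val + (x.val.2.val - sposn x.val.1.val)

theorem sposn_le (i : ℕ) (hi : 1 ≤ i) : sposn i ≤ i := by
  unfold sposn qsize; split <;> omega

theorem pjRank_lt {j : ℕ} (x : PJ j) : pjRank x < j + 2 := by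
  obtain ⟨⟨a, b⟩, h1, h2, h3⟩ := x
  dsimp only at h1 h2 h3
  have := sposn_add_two a h1
  have := sposn_le a h1
  simp only [pjRank]
  split <;> omega

theorem eq_of_le_of_pjRank_eq {j : ℕ} {x y : PJ j} (h : x ≤ y)
    (hr : pjRank x = pjRank y) : x = y := by
  have hx := sposn_le _ x.2.1
  have hy := sposn_le _ y.2.1
  have := x.2.1
  unfold pjRank at hr
  rcases (h : ple x y) with ⟨h1, h2⟩ | ⟨h1, h2, h3⟩
  · refine PJ.ext_val h1 ?_
    rw [h1] at hr hx
    split at hr <;> split at hr <;> omega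
  · split at hr <;> split at hr <;> omega

theorem heightPO_pjle (j : ℕ) (hj : 1 ≤ j) : heightPO (pjle j) = j + 2 := by
  apply sSup_ncard_eq
  · let f : Fin (j + 2) → PJ j := fun k =>
      if h0 : k.val = 0 then uElt j hj
      else if h : k.val ≤ j then sElt j k.val (by omega) h
      else rElt j j hj le_rfl
    have hrank : ∀ k, pjRank (f k) = k.val := by
      intro k
      have hs := sposn_add_two j hj
      have h1 : sposn 1 = 1 := rfl
      simp only [f]
      split_ifs
      · simp [pjRank, uElt, h1]; omega
      · simp [pjRank, sElt]
      · have hr : ¬ qsize j - 1 < sposn j := by omega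
        have hrj : pjRank (rElt j j hj le_rfl) = j + (qsize j - 1 - sposn j) := if_neg hr
        omega
    have hf : Function.Injective f := fun a b h =>
      Fin.ext (by rw [← hrank a, ← hrank b, h])
    have hmono : Monotone f := by
      intro a b hab
      have hab' : a.val ≤ b.val := hab
      have hs := sposn_add_two j hj
      have h1 : sposn 1 = 1 := rfl
      change ple _ _
      simp only [f]
      split_ifs
      · exact Or.inl ⟨rfl, le_rfl⟩
      · rcases Nat.eq_or_lt_of_le (show 1 ≤ b.val by omega) with h | h
        · exact Or.inl ⟨h, Nat.zero_le _⟩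
        · exact Or.inr ⟨h, Nat.zero_le _, le_rfl⟩
      · rcases Nat.eq_or_lt_of_le hj with h | h
        · exact Or.inl ⟨h, Nat.zero_le _⟩
        · exact Or.inr ⟨h, Nat.zero_le _, show sposn j ≤ qsize j - 1 by omega⟩
      · omega
      · rcases Nat.eq_or_lt_of_le hab' with h | h
        · exact Or.inl ⟨h, show sposn a.val ≤ sposn b.val by rw [h]⟩
        · exact Or.inr ⟨h, le_rfl, le_rfl⟩
      · rcases Nat.eq_or_lt_of_le (show a.val ≤ j by assumption) with h | h
        · exact Or.inl ⟨h, show sposn a.val ≤ qsize j - 1 by rw [h]; omega⟩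
        · exact Or.inr ⟨h, le_rfl, show sposn j ≤ qsize j - 1 by omega⟩
      · omega
      · omega
      · exact Or.inl ⟨rfl, le_rfl⟩
    refine ⟨Set.range f, ?_, by simp [Set.ncard_range_of_injective hf]⟩
    exact hmono.isChain_range
  · intro s hs
    have hinj : Set.InjOn (pjRank (j := j)) s := by
      intro x hx y hy hxy
      rcases hs.total (r := (· ≤ ·)) hx hy with h | h
      · exact eq_of_le_of_pjRank_eq h hxy
      · exact (eq_of_le_of_pjRank_eq h hxy.symm).symm
    have := Set.ncard_le_ncard_of_injOn (t := ↑(Finset.range (j + 2))) _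
      (fun x _ => by simpa using pjRank_lt x) hinj (Finset.finite_toSet _)
    simpa [Set.ncard_coe_finset] using this

theorem qsize_le (i j : ℕ) (hij : i ≤ j) : qsize i ≤ j + 2 := by
  unfold qsize; split <;> omega

/-- `PJ j` is the disjoint union of the chains `Q 1, …, Q j`. -/
def pjEquivSigma (j : ℕ) : PJ j ≃ Σ i : Fin j, Fin (qsize (i.val + 1)) where
  toFun x := ⟨⟨x.val.1.val - 1, by have := x.2.1; have := x.2.2.1; omega⟩,
    ⟨x.val.2.val, by
      have h := x.2.2.2
      have h1 := x.2.1
      simpa only [Nat.sub_add_cancel h1] using h⟩⟩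
  invFun y := ⟨(⟨y.1.val + 1, by omega⟩, ⟨y.2.val,
    lt_of_lt_of_le y.2.2 (qsize_le _ j (by omega))⟩),
    Nat.le_add_left _ _, y.1.2, y.2.2⟩
  left_inv x := PJ.ext_val (Nat.sub_add_cancel x.2.1) rfl
  right_inv _ := rfl

theorem card_PJ (j : ℕ) (hj : 1 ≤ j) : Fintype.card (PJ j) = (j + 2).choose 2 := by
  rw [Fintype.card_congr (pjEquivSigma j)]
  simp only [Fintype.card_sigma, Fintype.card_fin]
  rw [Fin.sum_univ_eq_sum_range (fun i => qsize (i + 1))]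
  induction j, hj using Nat.le_induction with
  | base => rfl
  | succ k hk ih =>
    rw [Finset.sum_range_succ, ih, Nat.choose_succ_succ' (k + 2) 1, Nat.choose_one_right,
      one_add_one_eq_two]
    unfold qsize
    split <;> omega

/-- For every positive integer `j`, the poset `P j` has width `j`, height `j + 2`,
and cardinality `(j+2).choose 2`. -/
theorem statement0 (j : ℕ) (hj : 1 ≤ j) :
    widthPO (pjle j) = j ∧ heightPO (pjle j) = j + 2 ∧
    Fintype.card (PJ j) = (j + 2).choose 2 := by
  exact ⟨widthPO_pjle j, heightPO_pjle j hj, card_PJ j hj⟩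
end

section
/- For every positive integer j, the maximum sizes of k-families of the poset P_j satisfy: d_1(P_j) = j; d_k(P_j) - d_{k-1}(P_j) = j+2-k for every k with 2 ≤ k ≤ j+1; and d_{j+2}(P_j) - d_{j+1}(P_j) = 1. -/
section General

variable {α : Type*} {r : α → α → Prop} {k : ℕ}

/-- A finite set carrying a `k`-valued labelling that separates comparable elements has at most
`dFam r k` elements. -/
theorem card_le_dFam [Finite α] (S : Finset α) (f : α → ℕ) (hf : ∀ x ∈ S, f x < k)
    (hr : ∀ x ∈ S, ∀ y ∈ S, r x y → x ≠ y → f x ≠ f y) : S.card ≤ dFam r k := by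
  refine le_csSup ⟨Nat.card α, ?_⟩ ⟨fun i => {x | x ∈ S ∧ f x = i}, ?_, ?_⟩
  · rintro n ⟨A, -, rfl⟩
    exact Set.ncard_le_card _
  · rintro i x ⟨hx, hxi⟩ y ⟨hy, hyi⟩ hne hxy
    exact hr x hx y hy hxy hne (hxi.trans hyi.symm)
  · rw [← Set.ncard_coe_finset]
    congr 1
    ext x
    simp only [Set.mem_iUnion, Set.mem_ofPred_eq, Finset.mem_coe]
    exact ⟨fun ⟨_, h, _⟩ => h, fun h => ⟨⟨f x, hf x h⟩, h, rfl⟩⟩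

/-- A chain meets a union of `k` antichains in at most `k` elements. -/
theorem IsChain.card_le_of_subset_iUnion {C : Finset α} (hC : IsChain r (C : Set α))
    {A : Fin k → Set α} (hA : ∀ i, IsAntichain r (A i)) (hCA : ∀ x ∈ C, ∃ i, x ∈ A i) :
    C.card ≤ k := by
  choose f hf using hCA
  have hinj : Function.Injective fun x : C => f x x.2 := by
    intro x y hxy
    by_contra hne
    have hne' : x.1 ≠ y.1 := fun h => hne (Subtype.ext h)
    have hx := hf x x.2
    rw [show f x x.2 = f y y.2 from hxy] at hx
    rcases hC x.2 y.2 hne' with h | h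
    · exact hA _ hx (hf y y.2) hne' h
    · exact hA _ (hf y y.2) hx hne'.symm h
  simpa using Fintype.card_le_of_injective _ hinj

end General

section Rows

variable {j : ℕ}

/-- The index `i` of the chain `Q i` containing an element of `P j`. -/
def PJ.row (x : PJ j) : ℕ := x.val.1.val

/-- The position of an element of `P j` within its chain. -/
def PJ.pos (x : PJ j) : ℕ := x.val.2.val

theorem PJ.one_le_row (x : PJ j) : 1 ≤ x.row := x.2.1

theorem PJ.row_le (x : PJ j) : x.row ≤ j := x.2.2.1

theorem PJ.pos_lt (x : PJ j) : x.pos < qsize x.row := x.2.2.2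

theorem PJ.ext_row_pos {x y : PJ j} (h : x.row = y.row) (h' : x.pos = y.pos) : x = y :=
  Subtype.ext (Prod.ext (Fin.ext h) (Fin.ext h'))

theorem PJ.exists_row_pos {i m : ℕ} (h1 : 1 ≤ i) (h2 : i ≤ j) (hm : m < qsize i) :
    ∃ x : PJ j, x.row = i ∧ x.pos = m :=
  ⟨⟨(⟨i, by omega⟩, ⟨m, by unfold qsize at hm; split at hm <;> omega⟩), h1, h2, hm⟩, rfl, rfl⟩

theorem pjle_iff {x y : PJ j} : pjle j x y ↔ (x.row = y.row ∧ x.pos ≤ y.pos) ∨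
    (x.row < y.row ∧ x.pos ≤ sposn x.row ∧ sposn y.row ≤ y.pos) := Iff.rfl

theorem card_eq_sum_row (S : Finset (PJ j)) :
    S.card = ∑ i ∈ Finset.Icc 1 j, (S.filter fun x => x.row = i).card :=
  Finset.card_eq_sum_card_fiberwise fun x _ =>
    Finset.mem_coe.2 (Finset.mem_Icc.2 ⟨x.one_le_row, x.row_le⟩)

theorem card_row_le_qsize (S : Finset (PJ j)) (i : ℕ) :
    (S.filter fun x => x.row = i).card ≤ qsize i := by
  rw [← Finset.card_range (qsize i)]
  refine Finset.card_le_card_of_injOn PJ.pos ?_ ?_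
  · intro x hx
    simp only [Finset.coe_filter, Set.mem_ofPred_eq] at hx
    simpa [← hx.2] using x.pos_lt
  · intro x hx y hy hxy
    simp only [Finset.coe_filter, Set.mem_ofPred_eq] at hx hy
    exact PJ.ext_row_pos (hx.2.trans hy.2.symm) hxy

theorem mem_of_card_row_eq {S : Finset (PJ j)} {i : ℕ}
    (h : qsize i ≤ (S.filter fun x => x.row = i).card) {x : PJ j} (hx : x.row = i) : x ∈ S := by
  by_contra hxS
  have h1 := card_row_le_qsize (insert x S) i
  rw [Finset.filter_insert, if_pos hx, Finset.card_insert_of_notMem (by simp [hxS])] at h1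
  omega

theorem sum_min_qsize (hj : 1 ≤ j) (k : ℕ) :
    ∑ i ∈ Finset.Icc 1 j, min k (qsize i) =
      (∑ i ∈ Finset.Icc 1 j, min k (i + 1)) + if 3 ≤ k then 1 else 0 := by
  have h : ∀ i ∈ Finset.Icc 1 j, min k (qsize i) =
      min k (i + 1) + if i = 1 then (if 3 ≤ k then 1 else 0) else 0 := by
    intro i _
    unfold qsize
    split_ifs <;> omega
  rw [Finset.sum_congr rfl h, Finset.sum_add_distrib, Finset.sum_ite_eq',
    if_pos (Finset.mem_Icc.2 ⟨le_rfl, hj⟩)]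

/-- The chain `u < s 1 < ⋯ < s m < r m`. -/
theorem exists_long_chain {m : ℕ} (h1 : 1 ≤ m) (hm : m ≤ j) :
    ∃ C : Finset (PJ j), IsChain (pjle j) (C : Set (PJ j)) ∧ (∀ x ∈ C, x.row ≤ m) ∧
      m + 2 ≤ C.card := by
  classical
  refine ⟨Finset.univ.filter fun x => x.row ≤ m ∧ (x.pos = sposn x.row ∨
    (x.row = 1 ∧ x.pos = 0) ∨ (x.row = m ∧ x.pos + 1 = qsize m)), ?_, ?_, ?_⟩
  · intro x hx y hy _
    simp only [Finset.coe_filter, Finset.mem_univ, true_and, Set.mem_ofPred_eq] at hx hy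
    have := x.one_le_row
    have := y.one_le_row
    simp only [pjle_iff]
    unfold sposn qsize at *
    grind
  · intro x hx
    exact (Finset.mem_filter.1 hx).2.1
  · rw [← Finset.card_range (m + 2)]
    refine Finset.card_le_card_of_surjOn
      (fun x => if x.row = 1 ∧ x.pos = 0 then 0 else if x.pos = sposn x.row then x.row
        else m + 1) ?_
    intro t ht
    rw [Finset.coe_range, Set.mem_Iio] at ht
    have hx : ∃ x : PJ j,
        x.row = (if t = 0 then 1 else if t ≤ m then t else m) ∧
        x.pos = (if t = 0 then 0 else if t ≤ m then sposn t else qsize m - 1) := by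
      apply PJ.exists_row_pos <;> grind [sposn, qsize]
    obtain ⟨x, hr, hp⟩ := hx
    refine ⟨x, ?_, ?_⟩
    · simp only [Finset.coe_filter, Finset.mem_univ, true_and, Set.mem_ofPred_eq, hr, hp]
      unfold sposn qsize
      grind
    · simp only [hr, hp]
      unfold sposn qsize
      grind

theorem isChain_row (S : Finset (PJ j)) (i : ℕ) :
    IsChain (pjle j) ((S.filter fun x => x.row = i : Finset (PJ j)) : Set (PJ j)) := by
  intro x hx y hy _
  simp only [Finset.coe_filter, Set.mem_ofPred_eq] at hx hy
  simp only [pjle_iff]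
  omega

theorem dFam_le_sum (hj : 1 ≤ j) {k : ℕ} (hk : k ≤ j + 1) :
    dFam (pjle j) k ≤ ∑ i ∈ Finset.Icc 1 j, min k (i + 1) := by
  classical
  refine csSup_le' ?_
  rintro n ⟨A, hA, rfl⟩
  obtain ⟨S, hS⟩ := (Set.toFinite (⋃ i, A i)).exists_finset_coe
  have hmem : ∀ x ∈ S, ∃ i, x ∈ A i := fun x hx => by
    simpa using hS.subset (Finset.mem_coe.2 hx)
  rw [← hS, Set.ncard_coe_finset, card_eq_sum_row]
  have hle : ∀ i ∈ Finset.Icc 1 j, (S.filter fun x => x.row = i).card ≤ min k (qsize i) :=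
    fun i _ => le_min ((isChain_row S i).card_le_of_subset_iUnion hA
      fun x hx => hmem x (Finset.mem_filter.1 hx).1) (card_row_le_qsize S i)
  have hsum := sum_min_qsize hj k
  by_cases h3 : 3 ≤ k
  · rw [if_pos h3] at hsum
    refine Nat.lt_succ_iff.1 (lt_of_lt_of_eq (Finset.sum_lt_sum hle ?_) hsum)
    by_contra! hcon
    obtain ⟨C, hC, hrow, hcard⟩ := exists_long_chain (j := j) (m := k - 1) (by omega) (by omega)
    have := hC.card_le_of_subset_iUnion hA fun x hx => hmem x <| by
      refine mem_of_card_row_eq ?_ rfl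
      have h1 := hcon x.row (Finset.mem_Icc.2 ⟨x.one_le_row, x.row_le⟩)
      have h2 := hrow x hx
      rwa [min_eq_right (by unfold qsize; split <;> omega)] at h1
    omega
  · rw [if_neg h3] at hsum
    exact (Finset.sum_le_sum hle).trans_eq hsum

theorem sum_le_dFam {k : ℕ} (hk : 1 ≤ k) :
    ∑ i ∈ Finset.Icc 1 j, min k (i + 1) ≤ dFam (pjle j) k := by
  classical
  let S : Finset (PJ j) := Finset.univ.filter fun x =>
    (x.row < k ∧ ¬ (x.row = 1 ∧ x.pos = 0)) ∨ (k ≤ x.row ∧ (x.pos + 1 < k ∧ x.row ≠ 1 ∨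
      x.pos + 1 = qsize x.row))
  have hS : ∑ i ∈ Finset.Icc 1 j, min k (i + 1) ≤ S.card := by
    rw [card_eq_sum_row]
    refine Finset.sum_le_sum fun i hi => ?_
    rw [Finset.mem_Icc] at hi
    rw [← Finset.card_range (min k (i + 1))]
    refine Finset.card_le_card_of_surjOn (fun x => if x.pos + 1 = qsize i then min k (i + 1) - 1
      else if i = 1 then x.pos - 1 else x.pos) ?_
    intro t ht
    rw [Finset.coe_range, Set.mem_Iio] at ht
    obtain ⟨x, hr, hp⟩ := PJ.exists_row_pos (j := j) (i := i)
      (m := if t + 1 = min k (i + 1) then qsize i - 1 else if i = 1 then t + 1 else t)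
      hi.1 hi.2 (by unfold qsize; grind)
    refine ⟨x, ?_, ?_⟩
    · simp only [S, Finset.coe_filter, Finset.mem_filter, Finset.mem_univ, true_and,
        Set.mem_ofPred_eq, hr, hp]
      unfold qsize
      grind
    · simp only [hp]
      unfold qsize
      grind
  refine hS.trans (card_le_dFam S (fun x => if x.pos + 1 = qsize x.row then k - 1
    else if x.row = 1 then x.pos - 1 else x.pos) ?_ ?_)
  · intro x hx
    have := x.pos_lt
    simp only [S, Finset.mem_filter, Finset.mem_univ, true_and] at hx
    unfold qsize at *
    grind
  · intro x hx y hy hxy hne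
    have := x.pos_lt
    have := y.pos_lt
    have := x.one_le_row
    have hne' : x.row = y.row → x.pos ≠ y.pos := fun h h' => hne (PJ.ext_row_pos h h')
    simp only [S, Finset.mem_filter, Finset.mem_univ, true_and] at hx hy
    rw [pjle_iff] at hxy
    unfold sposn qsize at *
    grind

theorem dFam_eq_sum (hj : 1 ≤ j) {k : ℕ} (h1 : 1 ≤ k) (hk : k ≤ j + 1) :
    dFam (pjle j) k = ∑ i ∈ Finset.Icc 1 j, min k (i + 1) :=
  (dFam_le_sum hj hk).antisymm (sum_le_dFam h1)

theorem card_PJ_s1 : Fintype.card (PJ j) = ∑ i ∈ Finset.Icc 1 j, qsize i := by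
  classical
  rw [← Finset.card_univ, card_eq_sum_row]
  refine Finset.sum_congr rfl fun i hi => (card_row_le_qsize _ i).antisymm ?_
  rw [Finset.mem_Icc] at hi
  rw [← Finset.card_range (qsize i)]
  refine Finset.card_le_card_of_surjOn PJ.pos fun t ht => ?_
  obtain ⟨x, hr, hp⟩ := PJ.exists_row_pos hi.1 hi.2 (Finset.mem_range.1 (Finset.mem_coe.1 ht))
  exact ⟨x, by simpa using hr, hp⟩

theorem dFam_top : dFam (pjle j) (j + 2) = Fintype.card (PJ j) := by
  refine le_antisymm (csSup_le' ?_) ?_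
  · rintro n ⟨A, -, rfl⟩
    exact (Set.ncard_le_card _).trans_eq Nat.card_eq_fintype_card
  · rw [← Finset.card_univ]
    refine card_le_dFam _ (fun x => if x.pos + 1 = qsize x.row then j + 1
      else if x.row = 1 then x.pos else x.pos + 1) (fun x _ => ?_) fun x _ y _ hxy hne => ?_
    · have := x.pos_lt
      have := x.row_le
      unfold qsize at *
      grind
    · have := x.pos_lt
      have := y.pos_lt
      have := x.one_le_row
      have := x.row_le
      have := y.row_le
      have hne' : x.row = y.row → x.pos ≠ y.pos := fun h h' => hne (PJ.ext_row_pos h h')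
      rw [pjle_iff] at hxy
      unfold sposn qsize at *
      grind

theorem sum_min_succ {k : ℕ} (h2 : 2 ≤ k) :
    ∑ i ∈ Finset.Icc 1 j, min k (i + 1) =
      (∑ i ∈ Finset.Icc 1 j, min (k - 1) (i + 1)) + (j + 2 - k) := by
  have h : ∀ i ∈ Finset.Icc 1 j, min k (i + 1) =
      min (k - 1) (i + 1) + if k - 1 ≤ i then 1 else 0 := by
    intro i _
    split_ifs <;> omega
  have hf : (Finset.Icc 1 j).filter (fun i => k - 1 ≤ i) = Finset.Icc (k - 1) j := by
    ext i
    simp only [Finset.mem_filter, Finset.mem_Icc]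
    omega
  rw [Finset.sum_congr rfl h, Finset.sum_add_distrib, ← Finset.card_filter, hf, Nat.card_Icc]
  omega

end Rows

/-- For every positive integer `j`: `d_1(P_j) = j`; `d_k(P_j) - d_{k-1}(P_j) = j + 2 - k`
for `2 ≤ k ≤ j + 1`; and `d_{j+2}(P_j) - d_{j+1}(P_j) = 1`. -/
theorem statement1 (j : ℕ) (hj : 1 ≤ j) :
    dFam (pjle j) 1 = j ∧
    (∀ k : ℕ, 2 ≤ k → k ≤ j + 1 →
      dFam (pjle j) k = dFam (pjle j) (k - 1) + (j + 2 - k)) ∧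
    dFam (pjle j) (j + 2) = dFam (pjle j) (j + 1) + 1 := by
  refine ⟨?_, fun k h2 hk => ?_, ?_⟩
  · rw [dFam_eq_sum hj le_rfl (by omega), Finset.sum_congr rfl fun i _ =>
      min_eq_left (Nat.le_add_left 1 i)]
    simp
  · rw [dFam_eq_sum hj (by omega) hk, dFam_eq_sum hj (by omega) (by omega), sum_min_succ h2]
  · have h := sum_min_qsize hj (j + 2)
    have hq : ∀ i ∈ Finset.Icc 1 j, min (j + 2) (qsize i) = qsize i := fun i hi => by
      rw [Finset.mem_Icc] at hi
      unfold qsize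
      split_ifs <;> omega
    rw [Finset.sum_congr rfl hq, if_pos (by omega), sum_min_succ (by omega)] at h
    rw [dFam_top, card_PJ_s1, h, dFam_eq_sum hj (by omega) le_rfl]
    simp
end

section
/- For every positive integer j, the poset P_j has order dimension at most 2; that is, there exist two linear orders ≤₁ and ≤₂ on the elements of P_j, each extending the partial order of P_j, such that for all elements x, y of P_j, x ≤ y in P_j if and only if x ≤₁ y and x ≤₂ y. -/
/-- Pulling back a linear order along an injective map gives a linear order. -/
theorem isLinearOrder_of_injective {α β : Type*} [LinearOrder β] {f : α → β}
    (hf : Function.Injective f) : IsLinearOrder α (fun x y => f x ≤ f y) where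
  refl _ := le_rfl
  trans _ _ _ := le_trans
  antisymm _ _ h h' := hf (le_antisymm h h')
  total _ _ := le_total _ _

/-- The level of an element of `P j`: `0` on `T i`, `1` at `s i` and `2` at `r i`. -/
def level {j : ℕ} (x : PJ j) : ℕ :=
  if x.val.2.val < sposn x.val.1.val then 0
  else if x.val.2.val = sposn x.val.1.val then 1 else 2

theorem level_cases {j : ℕ} (x : PJ j) :
    (x.val.2.val < sposn x.val.1.val ∧ level x = 0) ∨
    (x.val.2.val = sposn x.val.1.val ∧ level x = 1) ∨
    (sposn x.val.1.val < x.val.2.val ∧ level x = 2) := by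
  unfold level
  split_ifs <;> omega

/-- The key of the linear extension `Q 1, Q 2, …, Q j`. -/
def chainKey {j : ℕ} (x : PJ j) : ℕ ×ₗ ℕ := toLex (x.val.1.val, x.val.2.val)

/-- The key of the linear extension `T j, …, T 1, s 1, …, s j, r j, …, r 1`. -/
def levelKey {j : ℕ} (x : PJ j) : ℕ ×ₗ ℤ ×ₗ ℕ :=
  toLex (level x, toLex (if level x = 1 then (x.val.1.val : ℤ) else -x.val.1.val, x.val.2.val))

theorem chainKey_injective {j : ℕ} : Function.Injective (chainKey (j := j)) := by
  intro x y h
  simp only [chainKey, EmbeddingLike.apply_eq_iff_eq, Prod.mk.injEq] at h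
  exact PJ.ext_val h.1 h.2

theorem levelKey_injective {j : ℕ} : Function.Injective (levelKey (j := j)) := by
  intro x y h
  simp only [levelKey, EmbeddingLike.apply_eq_iff_eq, Prod.mk.injEq] at h
  obtain ⟨hl, hi, hm⟩ := h
  refine PJ.ext_val ?_ hm
  rw [hl] at hi
  split_ifs at hi <;> omega

theorem le_iff_chainKey_le_and_levelKey_le {j : ℕ} (x y : PJ j) :
    x ≤ y ↔ chainKey x ≤ chainKey y ∧ levelKey x ≤ levelKey y := by
  change ple x y ↔ _
  have hs : x.val.1.val = y.val.1.val → sposn x.val.1.val = sposn y.val.1.val :=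
    congrArg sposn
  have hx := level_cases x
  have hy := level_cases y
  simp only [ple, chainKey, levelKey, Prod.Lex.toLex_le_toLex]
  generalize level x = a at *
  generalize level y = b at *
  split_ifs <;> omega

/-- For every positive integer `j`, the poset `P j` has order dimension at most 2:
there are two linear orders, each extending the order of `P j`, whose intersection is
exactly the order of `P j`. -/
theorem statement2 (j : ℕ) (hj : 1 ≤ j) :
    ∃ L₁ L₂ : PJ j → PJ j → Prop,
      IsLinearOrder (PJ j) L₁ ∧ IsLinearOrder (PJ j) L₂ ∧
      (∀ x y : PJ j, x ≤ y → L₁ x y) ∧ (∀ x y : PJ j, x ≤ y → L₂ x y) ∧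
      (∀ x y : PJ j, x ≤ y ↔ L₁ x y ∧ L₂ x y) := by
  refine ⟨fun x y => chainKey x ≤ chainKey y, fun x y => levelKey x ≤ levelKey y,
    isLinearOrder_of_injective chainKey_injective, isLinearOrder_of_injective levelKey_injective,
    fun x y h => ((le_iff_chainKey_le_and_levelKey_le x y).1 h).1,
    fun x y h => ((le_iff_chainKey_le_and_levelKey_le x y).1 h).2,
    le_iff_chainKey_le_and_levelKey_le⟩
end

section
/- For every positive integer j and every positive integer k, the poset P_j admits a chain partition that is simultaneously k-saturated and (k+1)-saturated. -/
open Classical in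
theorem ncard_eq_sum_ncard_inter_fiber {α : Type*} [Fintype α] (f : α → α) (s : Set α) :
    s.ncard = ∑ v : α, (s ∩ f ⁻¹' {v}).ncard := by
  have h := Finset.card_eq_sum_card_fiberwise (f := f) (s := s.toFinset) (t := Finset.univ)
    (fun x _ => by simp)
  rw [Set.ncard_eq_toFinset_card', h]
  refine Finset.sum_congr rfl fun v _ => ?_
  rw [Set.ncard_eq_toFinset_card']
  congr 1
  ext x
  simp

/-- A `k`-family has at most as many elements as the `k`-norm of any chain partition. -/
theorem ncard_iUnion_le_knorm {α : Type*} [Fintype α] {r : α → α → Prop} {f : α → α} {k : ℕ}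
    (hf : IsChainPartition r f) (A : Fin k → Set α) (hA : ∀ i, IsAntichain r (A i)) :
    (⋃ i, A i).ncard ≤ knorm f k := by
  rw [ncard_eq_sum_ncard_inter_fiber f, knorm]
  refine Finset.sum_le_sum fun v _ => le_min ?_ (Set.ncard_le_ncard Set.inter_subset_right)
  have hle : ∀ i, (A i ∩ f ⁻¹' {v}).ncard ≤ 1 := fun i =>
    Set.ncard_le_one_iff_subsingleton.2
      (inter_subsingleton_of_isAntichain_of_isChain (hA i) (hf v))
  rw [Set.iUnion_inter]
  calc (⋃ i, A i ∩ f ⁻¹' {v}).ncard ≤ ∑ i, (A i ∩ f ⁻¹' {v}).ncard :=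
        Set.ncard_iUnion_le_of_fintype _
    _ ≤ ∑ _i : Fin k, 1 := Finset.sum_le_sum fun i _ => hle i
    _ = k := by simp

/-- A chain partition is `k`-saturated if it is orthogonal to the `k`-family given by the levels
below `k` of some function, that is, if each chain is contained in the family or meets each of
its levels. -/
theorem knorm_eq_dFam_of_orthogonal {α : Type*} [Fintype α] {r : α → α → Prop} {f : α → α}
    {k : ℕ} (hf : IsChainPartition r f) (lev : α → ℕ)
    (hlev : ∀ i < k, IsAntichain r {x | lev x = i})
    (horth : ∀ v, (∀ x, f x = v → lev x < k) ∨ ∀ i < k, ∃ x, f x = v ∧ lev x = i) :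
    knorm f k = dFam r k := by
  have hbdd : ∀ n ∈ {n | ∃ A : Fin k → Set α, (∀ i, IsAntichain r (A i)) ∧
      (⋃ i, A i).ncard = n}, n ≤ knorm f k := by
    rintro n ⟨A, hA, rfl⟩
    exact ncard_iUnion_le_knorm hf A hA
  let A : Fin k → Set α := fun i => {x | lev x = i}
  have hmem : (⋃ i, A i).ncard ∈ {n | ∃ A : Fin k → Set α, (∀ i, IsAntichain r (A i)) ∧
      (⋃ i, A i).ncard = n} := ⟨A, fun i => hlev i i.2, rfl⟩
  refine le_antisymm (le_trans ?_ (le_csSup ⟨_, hbdd⟩ hmem)) (csSup_le ⟨_, hmem⟩ hbdd)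
  rw [ncard_eq_sum_ncard_inter_fiber f, knorm]
  refine Finset.sum_le_sum fun v _ => ?_
  rcases horth v with h | h
  · refine (min_le_right _ _).trans (Set.ncard_le_ncard fun x hx => ⟨?_, hx⟩)
    exact Set.mem_iUnion.2 ⟨⟨lev x, h x hx⟩, rfl⟩
  · refine (min_le_left _ _).trans ?_
    choose g hgf hgl using fun i : Fin k => h i i.2
    have hinj : Function.Injective g := fun a b hab => by
      apply Fin.ext
      rw [← hgl a, ← hgl b, hab]
    calc k = (Set.range g).ncard := by
          rw [← Set.image_univ, Set.ncard_image_of_injective _ hinj]; simp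
      _ ≤ _ := Set.ncard_le_ncard (by
          rintro _ ⟨i, rfl⟩
          exact ⟨Set.mem_iUnion.2 ⟨i, hgl i⟩, hgf i⟩)

theorem sposn_one : sposn 1 = 1 := rfl

theorem sposn_of_two_le {a : ℕ} (ha : 2 ≤ a) : sposn a = a - 1 := by
  simp only [sposn, qsize]
  split <;> omega

theorem qsize_eq (a : ℕ) (ha : 1 ≤ a) : qsize a = sposn a + 2 := by
  simp only [sposn, qsize]
  split <;> omega

namespace PJ

variable {j : ℕ}

/-- The index `i` of the chain `Q i` containing an element. -/
def idx (x : PJ j) : ℕ := x.val.1.val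

/-- The position of an element within its chain `Q i`. -/
def pos_s3 (x : PJ j) : ℕ := x.val.2.val

theorem pjle_iff (x y : PJ j) : pjle j x y ↔ (x.idx = y.idx ∧ x.pos_s3 ≤ y.pos_s3) ∨
    (x.idx < y.idx ∧ x.pos_s3 ≤ sposn x.idx ∧ sposn y.idx ≤ y.pos_s3) := Iff.rfl

theorem ext_idx_pos {x y : PJ j} (h : x.idx = y.idx) (h' : x.pos_s3 = y.pos_s3) : x = y :=
  Subtype.ext (Prod.ext (Fin.ext h) (Fin.ext h'))

theorem one_le_idx (x : PJ j) : 1 ≤ x.idx := x.2.1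

theorem idx_le (x : PJ j) : x.idx ≤ j := x.2.2.1

theorem pos_le (x : PJ j) : x.pos_s3 ≤ sposn x.idx + 1 := by
  have h : x.pos_s3 < qsize x.idx := x.2.2.2
  rw [qsize_eq _ x.one_le_idx] at h
  omega

theorem exists_idx_pos {a p : ℕ} (ha : 1 ≤ a) (haj : a ≤ j) (hp : p ≤ sposn a + 1) :
    ∃ x : PJ j, x.idx = a ∧ x.pos_s3 = p := by
  have hq := qsize_eq a ha
  have hq' : qsize a ≤ j + 2 := by simp only [qsize]; split <;> omega
  exact ⟨⟨(⟨a, by omega⟩, ⟨p, by omega⟩), ha, haj, show p < qsize a by omega⟩, rfl, rfl⟩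

theorem idx_rElt {a : ℕ} (h1 : 1 ≤ a) (h2 : a ≤ j) : (rElt j a h1 h2).idx = a := rfl

/-- The level of an element in a maximum `k`-family; elements outside the family have level `k`. -/
def level (k : ℕ) (x : PJ j) : ℕ :=
  if sposn x.idx < x.pos_s3 then k - 1
  else if x.pos_s3 = sposn x.idx then (if x.idx + 2 ≤ k then x.idx else k)
  else if x.pos_s3 + 2 ≤ k then x.pos_s3 else k

theorem isAntichain_level {k i : ℕ} (hi : i < k) :
    IsAntichain (pjle j) {x | level k x = i} := by
  intro x hx y hy hne hxy
  rw [pjle_iff] at hxy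
  have hne' : ¬ (x.idx = y.idx ∧ x.pos_s3 = y.pos_s3) := fun h => hne (ext_idx_pos h.1 h.2)
  simp only [Set.mem_ofPred_eq, level] at hx hy
  have hx1 := x.one_le_idx
  have hxp := x.pos_le
  have hyp := y.pos_le
  have hx2 : (x.idx = 1 ∧ sposn x.idx = 1) ∨ (2 ≤ x.idx ∧ sposn x.idx = x.idx - 1) := by
    rcases hx1.eq_or_lt with h | h
    · exact Or.inl ⟨h.symm, by rw [← h]; rfl⟩
    · exact Or.inr ⟨h, sposn_of_two_le h⟩
  rcases hxy with ⟨h, h'⟩ | ⟨h, h', h''⟩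
  · rw [← h] at hy hyp hne'
    split_ifs at hx hy <;> omega
  · split_ifs at hx hy <;> omega

/-- Membership in the chain `u < s_1 < ⋯ < s_m < r_m`. -/
def InSpine (m : ℕ) (x : PJ j) : Prop :=
  x.idx ≤ m ∧ (x.pos_s3 = sposn x.idx ∨ (x.idx = 1 ∧ x.pos_s3 = 0) ∨
    (x.idx = m ∧ sposn x.idx < x.pos_s3))

open Classical in
/-- The partition of `P j` into the chain `u < s_1 < ⋯ < s_m < r_m` and the remainders of
the chains `Q i`. -/
noncomputable def spinePartition (hj : 1 ≤ j) (m : ℕ) (x : PJ j) : PJ j :=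
  if InSpine m x then sElt j 1 le_rfl hj else rElt j x.idx x.one_le_idx x.idx_le

theorem sElt_one_ne_rElt (hj : 1 ≤ j) {a : ℕ} (h1 : 1 ≤ a) (h2 : a ≤ j) :
    sElt j 1 le_rfl hj ≠ rElt j a h1 h2 := by
  intro h
  have hi : 1 = a := congrArg idx h
  subst hi
  have hp : 1 = 2 := congrArg pos_s3 h
  omega

theorem isChainPartition_spinePartition (hj : 1 ≤ j) (m : ℕ) :
    IsChainPartition (pjle j) (spinePartition hj m) := by
  intro v x hx y hy _
  have hxy : spinePartition hj m x = spinePartition hj m y := Eq.trans hx (Eq.symm hy)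
  simp only [pjle_iff]
  unfold spinePartition at hxy
  split_ifs at hxy with h h' h'
  · obtain ⟨hx1, hx2⟩ := h
    obtain ⟨hy1, hy2⟩ := h'
    have hsx : x.idx = 1 → sposn x.idx = 1 := fun h => by rw [h, sposn_one]
    have hsy : y.idx = 1 → sposn y.idx = 1 := fun h => by rw [h, sposn_one]
    have hx0 := x.one_le_idx
    have hy0 := y.one_le_idx
    rcases lt_trichotomy x.idx y.idx with hlt | heq | hlt
    · left; right
      rcases hx2 with h | ⟨h, h'⟩ | ⟨h, h'⟩ <;> rcases hy2 with g | ⟨g, g'⟩ | ⟨g, g'⟩ <;> omega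
    · omega
    · right; right
      rcases hx2 with h | ⟨h, h'⟩ | ⟨h, h'⟩ <;> rcases hy2 with g | ⟨g, g'⟩ | ⟨g, g'⟩ <;> omega
  · exact absurd hxy (sElt_one_ne_rElt hj _ _)
  · exact absurd hxy.symm (sElt_one_ne_rElt hj _ _)
  · have h := congrArg idx hxy
    rw [idx_rElt, idx_rElt] at h
    omega

theorem spinePartition_orthogonal (hj : 1 ≤ j) {m k : ℕ} (hm : 1 ≤ m) (hmj : m ≤ j)
    (hmk : m ≤ k) (hkm : m < j → k ≤ m + 1) (v : PJ j) :
    (∀ x, spinePartition hj m x = v → level k x < k) ∨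
      ∀ i < k, ∃ x, spinePartition hj m x = v ∧ level k x = i := by
  refine or_iff_not_imp_left.2 fun hnot i hi => ?_
  push Not at hnot
  obtain ⟨x, rfl, hx⟩ := hnot
  have hx1 := x.one_le_idx
  have hxj := x.idx_le
  have hs1 : x.idx = 1 → sposn x.idx = 1 := fun h => by rw [h, sposn_one]
  have hs2 : x.idx ≠ 1 → sposn x.idx = x.idx - 1 := fun h => sposn_of_two_le (by omega)
  have hxr : ¬ sposn x.idx < x.pos_s3 := by
    intro h
    rw [level, if_pos h] at hx
    omega
  by_cases hsp : InSpine m x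
  · have hfib : ∀ y, InSpine m y → spinePartition hj m y = spinePartition hj m x := by
      intro y hy
      simp only [spinePartition, if_pos hy, if_pos hsp]
    obtain ⟨hxm, hxc⟩ := hsp
    rcases Nat.lt_or_ge (i + 1) k with hik | hik
    · rcases Nat.eq_zero_or_pos i with rfl | hi0
      · obtain ⟨y, ha, hp⟩ := exists_idx_pos (p := 0) le_rfl hj (by omega)
        refine ⟨y, hfib y ⟨by omega, by simp [ha, hp]⟩, ?_⟩
        rw [level, ha, hp, sposn_one, if_neg (by omega), if_neg (by omega), if_pos (by omega)]
      · have him : i ≤ m := by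
          unfold level at hx
          split_ifs at hx <;> omega
        obtain ⟨y, ha, hp⟩ := exists_idx_pos (p := sposn i) hi0 (him.trans hmj) (by omega)
        refine ⟨y, hfib y ⟨by omega, by simp [ha, hp]⟩, ?_⟩
        rw [level, ha, hp, if_neg (by omega), if_pos rfl, if_pos (by omega)]
    · obtain ⟨y, ha, hp⟩ := exists_idx_pos (p := sposn m + 1) hm hmj le_rfl
      refine ⟨y, hfib y ⟨by omega, by simp [ha, hp]⟩, ?_⟩
      rw [level, ha, hp, if_pos (by omega)]
      omega
  · have hxm : m < x.idx := by
      by_contra hle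
      refine hsp ⟨by omega, ?_⟩
      unfold level at hx
      rcases eq_or_ne x.idx 1 with h | h
      · have := hs1 h
        omega
      · have := hs2 h
        split_ifs at hx <;> omega
    have hk := hkm (by omega)
    have hs := hs2 (by omega)
    have hfib : ∀ y, y.idx = x.idx → spinePartition hj m y = spinePartition hj m x := by
      intro y hy
      have hy' : ¬ InSpine m y := fun h => by have := h.1; omega
      simp only [spinePartition, if_neg hy', if_neg hsp, hy]
    rcases Nat.lt_or_ge (i + 1) k with hik | hik
    · obtain ⟨y, ha, hp⟩ := exists_idx_pos (p := i) hx1 hxj (by omega)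
      refine ⟨y, hfib y ha, ?_⟩
      rw [level, ha, hp, if_neg (by omega), if_neg (by omega), if_pos (by omega)]
    · obtain ⟨y, ha, hp⟩ := exists_idx_pos (p := sposn x.idx + 1) hx1 hxj le_rfl
      refine ⟨y, hfib y ha, ?_⟩
      rw [level, ha, hp, if_pos (by omega)]
      omega

theorem knorm_spinePartition (hj : 1 ≤ j) {m k : ℕ} (hm : 1 ≤ m) (hmj : m ≤ j)
    (hmk : m ≤ k) (hkm : m < j → k ≤ m + 1) :
    knorm (spinePartition hj m) k = dFam (pjle j) k :=
  knorm_eq_dFam_of_orthogonal (isChainPartition_spinePartition hj m) (level k)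
    (fun _ hi => isAntichain_level hi) (spinePartition_orthogonal hj hm hmj hmk hkm)

end PJ

/-- For every positive integer `j` and every positive integer `k`, the poset `P j`
admits a chain partition that is simultaneously `k`-saturated and `(k+1)`-saturated. -/
theorem statement3 (j : ℕ) (hj : 1 ≤ j) (k : ℕ) (hk : 0 < k) :
    ∃ f : PJ j → PJ j, IsChainPartition (pjle j) f ∧
      knorm f k = dFam (pjle j) k ∧ knorm f (k + 1) = dFam (pjle j) (k + 1) :=
  ⟨PJ.spinePartition hj (min k j), PJ.isChainPartition_spinePartition hj _,
    PJ.knorm_spinePartition hj (by omega) (by omega) (by omega) (by omega),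
    PJ.knorm_spinePartition hj (by omega) (by omega) (by omega) (by omega)⟩
end
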